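/- Let Γ = (V,E) and Γ' = (V',E') be finite simple graphs, and let (G_v)_{v∈V} and (G'_{v'})_{v'∈V'} be families of nontrivial finite groups each of which is directly indecomposable. If the graph product of (Γ, G_v) is isomorphic as a group to the graph product of (Γ', G'_{v'}), then there exists a graph isomorphism ψ : Γ → Γ' such that G_v is isomorphic to G'_{ψ(v)} for every v ∈ V. (Thus a representation of a group as a graph product of directly indecomposable finite groups is unique.) -/

import Mathlib

open Monoid

/-- The set of commutator relators defining a graph product. -/
def graphProdRels {V : Type*} (Γ : SimpleGraph V) (G : V → Type*) [∀ v, Group (G v)] :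
    Set (CoprodI G) :=
  {x | ∃ (u v : V) (_ : Γ.Adj u v) (g : G u) (h : G v),
    x = (CoprodI.of g)⁻¹ * (CoprodI.of h)⁻¹ * CoprodI.of g * CoprodI.of h}

/-- The graph product of the graph of groups `(Γ, G)`: the quotient of the free product of the
vertex groups by the normal closure of the commutators of elements of pairs of adjacent vertex
groups. -/
def GraphProduct {V : Type*} (Γ : SimpleGraph V) (G : V → Type*) [∀ v, Group (G v)] : Type _ :=
  CoprodI G ⧸ Subgroup.normalClosure (graphProdRels Γ G)

instance {V : Type*} (Γ : SimpleGraph V) (G : V → Type*) [∀ v, Group (G v)] :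
    Group (GraphProduct Γ G) :=
  QuotientGroup.Quotient.group _

/-- The canonical map from a vertex group into the graph product. -/
def GraphProduct.of {V : Type*} (Γ : SimpleGraph V) (G : V → Type*) [∀ v, Group (G v)] (v : V) :
    G v →* GraphProduct Γ G :=
  (QuotientGroup.mk' _).comp CoprodI.of

/-- `G(A)`: the subgroup of the graph product generated by the images of the vertex groups
`G_a`, `a ∈ A`. -/
def GraphProduct.vsub {V : Type*} (Γ : SimpleGraph V) (G : V → Type*) [∀ v, Group (G v)]
    (A : Set V) : Subgroup (GraphProduct Γ G) :=
  ⨆ a ∈ A, (GraphProduct.of Γ G a).range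

/-- A group is directly indecomposable if it is nontrivial and, whenever it is isomorphic to a
direct product `K × L`, either `K` or `L` is trivial. -/
def DirectlyIndecomposable (H : Type*) [Group H] : Prop :=
  Nontrivial H ∧ ∀ (K L : Type) [Group K] [Group L],
    Nonempty (H ≃* K × L) → Subsingleton K ∨ Subsingleton L


namespace GPRigid

universe u v w x y

lemma indec_univ {H : Type u} [Group H] [Finite H] (hH : DirectlyIndecomposable H)
    (K : Type v) (L : Type w) [Group K] [Group L] (e : H ≃* K × L) :
    Subsingleton K ∨ Subsingleton L := by
  have : Finite (K × L) := Finite.of_equiv H e.toEquiv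
  have : Finite K := Finite.of_surjective (Prod.fst : K × L → K) Prod.fst_surjective
  have : Finite L := Finite.of_surjective (Prod.snd : K × L → L) Prod.snd_surjective
  have h := hH.2 (Shrink.{0} K) (Shrink.{0} L)
    ⟨e.trans (MulEquiv.prodCongr ((equivShrink.{0} K).symm.mulEquiv).symm
      ((equivShrink.{0} L).symm.mulEquiv).symm)⟩
  rcases h with h | h
  · left; exact (equivShrink.{0} K).subsingleton
  · right; exact (equivShrink.{0} L).subsingleton

lemma indec_congr {H : Type u} {K : Type v} [Group H] [Group K]
    (hH : DirectlyIndecomposable H) (e : H ≃* K) : DirectlyIndecomposable K := by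
  refine ⟨?_, ?_⟩
  · have := hH.1
    exact e.symm.toEquiv.nontrivial
  · intro A B _ _ ⟨f⟩
    exact hH.2 A B ⟨e.trans f⟩

/-- A retraction whose section has normal range splits off a direct factor. -/
lemma split_of_section {G : Type u} {Q : Type v} [Group G] [Group Q] (p : G →* Q) (s : Q →* G)
    (h : ∀ q, p (s q) = q) (hn : ∀ g q, ∃ q', g * s q * g⁻¹ = s q') :
    Nonempty (G ≃* Q × p.ker) := by
  have hc : ∀ q (k : p.ker), (k : G) * s q = s q * k := by
    intro q k
    obtain ⟨q', hq'⟩ := hn k q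
    have : q = q' := by
      have := congrArg p hq'
      rw [h, map_mul, map_mul, h, map_inv, k.2] at this
      simpa using this
    rw [← this] at hq'
    exact mul_inv_eq_iff_eq_mul.mp hq'
  let f : Q × p.ker →* G :=
    { toFun := fun z => s z.1 * z.2
      map_one' := by simp
      map_mul' := by
        rintro ⟨q, k⟩ ⟨q', k'⟩
        simp only [Prod.mk_mul_mk, map_mul, Subgroup.coe_mul]
        rw [mul_assoc, mul_assoc, ← mul_assoc (k : G), hc q' k, mul_assoc] }
  have hf : Function.Bijective f := by
    constructor
    · rw [injective_iff_map_eq_one]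
      rintro ⟨q, k⟩ hz
      have hz' : s q * k = 1 := hz
      have hq : q = 1 := by
        have := congrArg p hz'
        rw [map_mul, h, k.2] at this
        simpa using this
      subst hq
      ext
      · rfl
      · simpa using hz'
    · intro g
      refine ⟨⟨p g, ⟨(s (p g))⁻¹ * g, ?_⟩⟩, ?_⟩
      · simp [MonoidHom.mem_ker, h]
      · show s (p g) * ((s (p g))⁻¹ * g) = g
        simp
  exact ⟨(MulEquiv.ofBijective f hf).symm⟩

lemma exists_idem_pow {M : Type u} [Monoid M] [Finite M] (a : M) :
    ∃ n, 1 ≤ n ∧ a ^ n * a ^ n = a ^ n := by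
  obtain ⟨i, j, hij, h⟩ := Finite.exists_ne_map_eq_of_infinite (fun n : ℕ => a ^ n)
  wlog hlt : i < j generalizing i j
  · exact this j i hij.symm h.symm (by omega)
  obtain ⟨d, rfl⟩ := Nat.exists_eq_add_of_lt hlt
  have key : ∀ m, i ≤ m → ∀ t, a ^ (m + t * (d + 1)) = a ^ m := by
    intro m hm t
    induction t with
    | zero => simp
    | succ t ih =>
      obtain ⟨c, rfl⟩ := Nat.exists_eq_add_of_le hm
      have h' : a ^ i = a ^ (i + d + 1) := h
      calc a ^ (i + c + (t + 1) * (d + 1)) = a ^ (i + d + 1) * a ^ (c + t * (d + 1)) := by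
            rw [← pow_add]; congr 1; ring
        _ = a ^ i * a ^ (c + t * (d + 1)) := by rw [h']
        _ = a ^ (i + c + t * (d + 1)) := by rw [← pow_add]; congr 1; ring
        _ = _ := ih
  refine ⟨(i + 1) * (d + 1), ?_, ?_⟩
  · nlinarith
  · rw [← pow_add]
    apply key
    nlinarith

/-- Fitting's lemma for normal endomorphisms of a finite indecomposable group. -/
lemma fitting {H : Type u} [Group H] [Finite H] (hH : DirectlyIndecomposable H) (θ : H →* H)
    (hθ : ∀ g h, θ (g * h * g⁻¹) = g * θ h * g⁻¹) :
    Function.Injective θ ∨ ∃ n, ∀ h, (θ^[n]) h = 1 := by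
  have : Finite (Monoid.End H) := Finite.of_injective (fun f : Monoid.End H => (f : H → H))
    DFunLike.coe_injective
  obtain ⟨n, hn, hid⟩ := exists_idem_pow (M := Monoid.End H) θ
  have hpow : ∀ m (h : H), ((show Monoid.End H from θ) ^ m) h = (θ^[m]) h := by
    intro m h
    rw [Monoid.End.coe_pow]; rfl
  set e : H →* H := ((show Monoid.End H from θ) ^ n : Monoid.End H) with he
  have hee : ∀ h, e (e h) = e h := fun h => DFunLike.congr_fun hid h
  have hen : ∀ g h, e (g * h * g⁻¹) = g * e h * g⁻¹ := by
    intro g h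
    have : ∀ m, (θ^[m]) (g * h * g⁻¹) = g * (θ^[m]) h * g⁻¹ := by
      intro m
      induction m with
      | zero => rfl
      | succ m ih => rw [Function.iterate_succ_apply', ih, hθ, Function.iterate_succ_apply']
    have h1 := hpow n (g * h * g⁻¹)
    have h2 := hpow n h
    rw [this] at h1
    rw [← h2] at h1
    exact h1
  obtain ⟨f⟩ := split_of_section (e.rangeRestrict) (e.range.subtype)
    (by rintro ⟨_, h, rfl⟩; ext; exact hee h)
    (by
      rintro g ⟨_, h, rfl⟩
      exact ⟨⟨e (g * h * g⁻¹), _, rfl⟩, (hen g h).symm⟩)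
  rcases indec_univ hH _ _ f with h | h
  · right
    refine ⟨n, fun a => ?_⟩
    rw [← hpow]
    have := congrArg Subtype.val (Subsingleton.elim (⟨e a, a, rfl⟩ : e.range) 1)
    exact this
  · left
    rw [injective_iff_map_eq_one]
    intro a ha
    have hea : e a = 1 := by
      have h1 : e a = (θ^[n]) a := hpow n a
      obtain ⟨m, rfl⟩ := Nat.exists_eq_add_of_le hn
      rw [h1, add_comm, Function.iterate_add_apply, Function.iterate_one, ha]
      exact iterate_map_one θ m
    have := congrArg Subtype.val (Subsingleton.elim
      (⟨a, by rw [MonoidHom.mem_ker]; ext; exact hea⟩ : e.rangeRestrict.ker) 1)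
    exact this

lemma ks_one {H : Type u} {X : Type v} {K : Type w} {L : Type x} [Group H] [Group X] [Group K]
    [Group L] [Finite H] (hH : DirectlyIndecomposable H) (e : H × X ≃* K × L) :
    Function.Bijective (fun h : H => (e.symm ((e (h, 1)).1, 1)).1) ∨
    Function.Bijective (fun h : H => (e.symm (1, (e (h, 1)).2)).1) := by
  let a : H →* H := (MonoidHom.fst H X).comp (e.symm.toMonoidHom.comp ((MonoidHom.inl K L).comp
    ((MonoidHom.fst K L).comp (e.toMonoidHom.comp (MonoidHom.inl H X)))))
  let b : H →* H := (MonoidHom.fst H X).comp (e.symm.toMonoidHom.comp ((MonoidHom.inr K L).comp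
    ((MonoidHom.snd K L).comp (e.toMonoidHom.comp (MonoidHom.inl H X)))))
  have ha : ∀ h, a h = (e.symm ((e (h, 1)).1, 1)).1 := fun h => rfl
  have hb : ∀ h, b h = (e.symm (1, (e (h, 1)).2)).1 := fun h => rfl
  have hab : ∀ h, a h * b h = h := by
    intro h
    rw [ha, hb, ← Prod.fst_mul, ← map_mul]
    simp
  have hna : ∀ g h, a (g * h * g⁻¹) = g * a h * g⁻¹ := by
    intro g h
    have h1 : e (g * h * g⁻¹, 1) = e (g, 1) * e (h, 1) * (e (g, 1))⁻¹ := by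
      rw [← map_inv, ← map_mul, ← map_mul]; simp
    have h2 : (((e (g, 1) * e (h, 1) * (e (g, 1))⁻¹)).1, (1 : L))
        = e (g, 1) * ((e (h, 1)).1, 1) * (e (g, 1))⁻¹ := by
      ext <;> simp
    rw [ha, ha, h1, h2, map_mul, map_mul, map_inv]
    simp
  rcases fitting hH a hna with h | ⟨n, h⟩
  · left
    exact Finite.injective_iff_bijective.mp h
  · right
    suffices hb' : Function.Injective b from Finite.injective_iff_bijective.mp hb'
    rw [injective_iff_map_eq_one]
    intro y hy
    have hay : a y = y := by simpa [hy] using hab y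
    rw [← h y]
    exact (Function.iterate_fixed hay n).symm

lemma ks_two {H : Type u} {X : Type v} {K : Type w} {L : Type x} [Group H] [Group X] [Group K]
    [Group L] (e : H × X ≃* K × L)
    (hbij : Function.Bijective (fun h : H => (e.symm ((e (h, 1)).1, 1)).1)) :
    ∃ Y : Subgroup K, Nonempty (K ≃* H × Y) ∧ Nonempty (X ≃* Y × L) := by
  let s0 : H →* K := (MonoidHom.fst K L).comp (e.toMonoidHom.comp (MonoidHom.inl H X))
  let p : K →* H := (MonoidHom.fst H X).comp (e.symm.toMonoidHom.comp (MonoidHom.inl K L))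
  have hs0 : ∀ h, s0 h = (e (h, 1)).1 := fun _ => rfl
  have hp : ∀ k, p k = (e.symm (k, 1)).1 := fun _ => rfl
  have hps : Function.Bijective (p.comp s0) := hbij
  let a : H ≃* H := MulEquiv.ofBijective (p.comp s0) hps
  have haa : ∀ h, p (s0 (a.symm h)) = h := fun h => a.apply_symm_apply h
  refine ⟨p.ker, ?_, ?_⟩
  · refine split_of_section p (s0.comp a.symm.toMonoidHom) haa ?_
    intro k h
    refine ⟨a ((p k) * a.symm h * (p k)⁻¹), ?_⟩
    show k * s0 (a.symm h) * k⁻¹ = s0 (a.symm (a _))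
    rw [a.symm_apply_apply]
    generalize a.symm h = h'
    rw [hs0, hs0, hp]
    have : ((e.symm (k, 1)).1 * h' * ((e.symm (k, 1)).1)⁻¹, (1 : X))
        = e.symm (k, 1) * (h', 1) * (e.symm (k, 1))⁻¹ := by
      ext <;> simp
    rw [this, map_mul, map_mul, map_inv]
    simp
  · let f : p.ker × L →* X := (MonoidHom.snd H X).comp (e.symm.toMonoidHom.comp
      ((p.ker.subtype).prodMap (MonoidHom.id L)))
    have hf : ∀ k l, f (k, l) = (e.symm ((k : K), l)).2 := fun _ _ => rfl
    have hfb : Function.Bijective f := by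
      constructor
      · rw [injective_iff_map_eq_one]
        rintro ⟨k, l⟩ hkl
        rw [hf] at hkl
        have h1 : e.symm ((k : K), l) = ((e.symm ((k : K), l)).1, 1) := by
          ext
          · rfl
          · exact hkl
        generalize (e.symm ((k : K), l)).1 = h at h1
        rw [MulEquiv.symm_apply_eq] at h1
        have h2 : (p.comp s0) h = 1 := by
          show p (e (h, 1)).1 = 1
          rw [← h1]
          exact k.2
        have h3 : h = 1 := (injective_iff_map_eq_one _).mp hps.1 h h2
        subst h3
        have h4 : ((k : K), l) = 1 := by rw [h1]; exact map_one e
        ext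
        · exact congrArg Prod.fst h4
        · exact (Prod.ext_iff.mp h4).2
      · intro y
        obtain ⟨h, hh⟩ := hps.2 (p (e (1, y)).1)⁻¹
        have hh' : p (e (h, 1)).1 = (p (e (1, y)).1)⁻¹ := hh
        have h5 : e (h, y) = e (h, 1) * e (1, y) := by rw [← map_mul]; simp
        refine ⟨(⟨(e (h, y)).1, ?_⟩, (e (h, y)).2), ?_⟩
        · rw [MonoidHom.mem_ker, h5, Prod.fst_mul, map_mul, hh']; simp
        · rw [hf]; simp
    exact ⟨(MulEquiv.ofBijective f hfb).symm⟩

def piSplit {J : Type u} [DecidableEq J] (L : J → Type v) [∀ j, Group (L j)] (j : J) :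
    (∀ k, L k) ≃* L j × ∀ k : {k // k ≠ j}, L k :=
  { Equiv.piSplitAt j L with map_mul' := fun _ _ => rfl }

def piReindex {J : Type u} (L : J → Type v) [∀ j, Group (L j)] (j₀ j : J)
    (h : j ≠ j₀) :
    (∀ k : {k : {k // k ≠ j₀} // k ≠ ⟨j, h⟩}, L k.1.1) ≃*
      (∀ k : {k : {k // k ≠ j} // k ≠ ⟨j₀, h.symm⟩}, L k.1.1) where
  toFun f k := f ⟨⟨k.1.1, fun hk => k.2 (Subtype.ext hk)⟩,
    fun hk => k.1.2 (congrArg Subtype.val hk)⟩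
  invFun f k := f ⟨⟨k.1.1, fun hk => k.2 (Subtype.ext hk)⟩,
    fun hk => k.1.2 (congrArg Subtype.val hk)⟩
  left_inv _ := rfl
  right_inv _ := rfl
  map_mul' _ _ := rfl

lemma ks_three_aux (n : ℕ) : ∀ {J : Type u} [Finite J] (_ : Nat.card J = n) (L : J → Type v)
    [∀ j, Group (L j)] [∀ j, Finite (L j)] (_ : ∀ j, DirectlyIndecomposable (L j))
    {H : Type w} [Group H] [Finite H] (_ : DirectlyIndecomposable H)
    {X : Type (max u v)} [Group X] (_ : H × X ≃* ∀ j, L j),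
    ∃ j, Nonempty (H ≃* L j) ∧ Nonempty (X ≃* ∀ k : {k // k ≠ j}, L k) := by
  classical
  induction n with
  | zero =>
    intro J _ hJ L _ _ hL H _ _ hH X _ e
    have : IsEmpty J := by
      rw [Nat.card_eq_zero] at hJ
      rcases hJ with h | h
      · exact h
      · exact absurd ‹Finite J› (not_finite_iff_infinite.mpr h)
    have := e.toEquiv.subsingleton
    obtain ⟨a, b, hab⟩ := hH.1
    exact absurd (congrArg Prod.fst (Subsingleton.elim (a, (1 : X)) (b, 1))) hab
  | succ n ih =>
    intro J _ hJ L _ _ hL H _ _ hH X _ e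
    have : Nonempty J := by
      by_contra h
      rw [not_nonempty_iff] at h
      simp at hJ
    obtain ⟨j₀⟩ := this
    let e1 := e.trans (piSplit L j₀)
    rcases ks_one hH e1 with hb | hb
    · obtain ⟨Y, ⟨f⟩, ⟨g⟩⟩ := ks_two e1 hb
      have hY : Subsingleton Y := by
        rcases indec_univ (hL j₀) _ _ f with h | h
        · obtain ⟨a, b, hab⟩ := hH.1
          exact absurd (Subsingleton.elim a b) hab
        · exact h
      have : Unique Y := ⟨⟨1⟩, fun a => Subsingleton.elim _ _⟩
      refine ⟨j₀, ⟨(f.trans MulEquiv.prodUnique).symm⟩, ⟨g.trans MulEquiv.uniqueProd⟩⟩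
    · obtain ⟨Y, ⟨f⟩, ⟨g⟩⟩ := ks_two (e1.trans MulEquiv.prodComm) hb
      obtain ⟨⟨j, hj⟩, hHj, ⟨r⟩⟩ := ih (J := {k // k ≠ j₀}) (by
          have := Nat.card_congr (Equiv.optionSubtypeNe j₀)
          rw [Finite.card_option] at this
          omega) (fun k => L k) (fun k => hL k) hH f.symm
      refine ⟨j, hHj, ⟨?_⟩⟩
      refine g.trans (((MulEquiv.prodCongr (r.trans (piReindex L j₀ j hj)) (MulEquiv.refl _)).trans
        MulEquiv.prodComm).trans ?_)
      exact (piSplit (fun k : {k // k ≠ j} => L k) ⟨j₀, hj.symm⟩).symm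

lemma ks_three {J : Type u} [Finite J] (L : J → Type v)
    [∀ j, Group (L j)] [∀ j, Finite (L j)] (hL : ∀ j, DirectlyIndecomposable (L j))
    {H : Type w} [Group H] [Finite H] (hH : DirectlyIndecomposable H) {X : Type x} [Group X]
    (e : H × X ≃* ∀ j, L j) :
    ∃ j, Nonempty (H ≃* L j) ∧ Nonempty (X ≃* ∀ k : {k // k ≠ j}, L k) := by
  let i : X →* ∀ j, L j := e.toMonoidHom.comp (MonoidHom.inr H X)
  have hi : Function.Injective i := by
    intro a b hab
    exact (Prod.ext_iff.mp (e.injective hab)).2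
  let f : X ≃* i.range := MonoidHom.ofInjective hi
  obtain ⟨j, h1, ⟨h2⟩⟩ := ks_three_aux _ rfl L hL hH
    ((MulEquiv.prodCongr (MulEquiv.refl H) f).symm.trans e)
  exact ⟨j, h1, ⟨f.trans h2⟩⟩

/-- The Krull–Remak–Schmidt theorem for finite groups. -/
theorem krull_schmidt (n : ℕ) : ∀ {I : Type u} {J : Type v} [Finite I] [Finite J]
    (_ : Nat.card I = n) (K : I → Type w) (L : J → Type x)
    [∀ i, Group (K i)] [∀ i, Finite (K i)] [∀ j, Group (L j)] [∀ j, Finite (L j)]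
    (_ : ∀ i, DirectlyIndecomposable (K i)) (_ : ∀ j, DirectlyIndecomposable (L j))
    (_ : (∀ i, K i) ≃* ∀ j, L j), ∃ e : I ≃ J, ∀ i, Nonempty (K i ≃* L (e i)) := by
  classical
  induction n with
  | zero =>
    intro I J _ _ hI K L _ _ _ _ hK hL e
    have : IsEmpty I := by
      rw [Nat.card_eq_zero] at hI
      rcases hI with h | h
      · exact h
      · exact absurd ‹Finite I› (not_finite_iff_infinite.mpr h)
    have hs := e.symm.toEquiv.subsingleton
    have : IsEmpty J := by
      constructor
      intro j
      obtain ⟨a, b, hab⟩ := (hL j).1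
      have h1 := congrFun (Subsingleton.elim (Pi.mulSingle j a) (Pi.mulSingle j b)) j
      simp only [Pi.mulSingle_eq_same] at h1
      exact hab h1
    exact ⟨Equiv.equivOfIsEmpty I J, fun i => isEmptyElim i⟩
  | succ n ih =>
    intro I J _ _ hI K L _ _ _ _ hK hL e
    have : Nonempty I := by
      by_contra h
      rw [not_nonempty_iff] at h
      simp at hI
    obtain ⟨i₀⟩ := this
    obtain ⟨j, ⟨h1⟩, ⟨h2⟩⟩ := ks_three L hL (hK i₀) ((piSplit K i₀).symm.trans e)
    obtain ⟨f, hf⟩ := ih (I := {i // i ≠ i₀}) (J := {k // k ≠ j}) (by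
          have := Nat.card_congr (Equiv.optionSubtypeNe i₀)
          rw [Finite.card_option] at this
          omega) (fun k => K k) (fun k => L k) (fun k => hK k) (fun k => hL k) h2
    refine ⟨(Equiv.optionSubtypeNe i₀).symm.trans (f.optionCongr.trans (Equiv.optionSubtypeNe j)),
      fun i => ?_⟩
    by_cases hi : i = i₀
    · subst hi
      have h3 : ((Equiv.optionSubtypeNe i).symm.trans
          (f.optionCongr.trans (Equiv.optionSubtypeNe j))) i = j := by simp
      rw [h3]
      exact ⟨h1⟩
    · have := hf ⟨i, hi⟩
      have h3 : ((Equiv.optionSubtypeNe i₀).symm.trans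
          (f.optionCongr.trans (Equiv.optionSubtypeNe j))) i = f ⟨i, hi⟩ := by
        simp [Equiv.optionSubtypeNe_symm_of_ne hi]
      rw [h3]
      exact this

end GPRigid


namespace GPRigid

section FixedPoint

open Monoid.CoprodI

variable {I B H : Type*} [Group B] [Group H] [MulAction H I]

/-- Free product of copies of `B` indexed by `I`. -/
abbrev FP (I B : Type*) [Group B] := CoprodI (fun _ : I => B)

/-- The letter `b` at the index `i`. -/
abbrev ofi (i : I) : B →* FP I B := CoprodI.of (M := fun _ : I => B) (i := i)

def permHom (B : Type*) [Group B] (e : I → I) : FP I B →* FP I B :=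
  CoprodI.lift (fun i => ofi (e i))

@[simp] lemma permHom_ofi (e : I → I) (i : I) (b : B) :
    permHom B e (ofi i b) = ofi (e i) b := by
  simp [permHom]

lemma permHom_comp (e e' : I → I) (x : FP I B) :
    permHom B e (permHom B e' x) = permHom B (e ∘ e') x := by
  have : (permHom B e).comp (permHom B e') = permHom B (e ∘ e') := by
    apply CoprodI.ext_hom
    intro i
    ext b
    simp [permHom]
  exact DFunLike.congr_fun this x

lemma permHom_id (x : FP I B) : permHom B (id : I → I) x = x := by
  have : (permHom B (id : I → I)) = MonoidHom.id _ := by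
    apply CoprodI.ext_hom
    intro i
    ext b
    simp [permHom]
  exact DFunLike.congr_fun this x

def permAut (I B H : Type*) [Group B] [Group H] [MulAction H I] : H →* MulAut (FP I B) where
  toFun h :=
    { toFun := permHom B (fun i => h • i)
      invFun := permHom B (fun i => h⁻¹ • i)
      left_inv := fun x => by
        rw [permHom_comp]
        convert permHom_id x
        ext i; simp
      right_inv := fun x => by
        rw [permHom_comp]
        convert permHom_id x
        ext i; simp
      map_mul' := fun x y => map_mul _ x y }
  map_one' := by
    ext x
    show permHom B _ x = x
    convert permHom_id x
    ext i; simp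
  map_mul' h h' := by
    ext x
    show permHom B _ x = permHom B _ (permHom B _ x)
    rw [permHom_comp]
    congr 2
    ext i; simp [mul_smul]

@[simp] lemma permAut_ofi (h : H) (i : I) (b : B) :
    permAut I B H h (ofi i b) = ofi (h • i) b := permHom_ofi _ i b

/-- Reduced lists. -/
def Red (l : List (Σ _ : I, B)) : Prop :=
  (∀ a ∈ l, a.2 ≠ 1) ∧ l.IsChain (fun a a' => a.1 ≠ a'.1)

def wprod (l : List (Σ _ : I, B)) : FP I B := (l.map fun a => ofi a.1 a.2).prod

@[simp] lemma wprod_nil : wprod ([] : List (Σ _ : I, B)) = 1 := rfl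
@[simp] lemma wprod_cons (a : Σ _ : I, B) (l) : wprod (a :: l) = ofi a.1 a.2 * wprod l := by
  simp [wprod]
@[simp] lemma wprod_append (l m : List (Σ _ : I, B)) : wprod (l ++ m) = wprod l * wprod m := by
  simp [wprod]

lemma exists_nf (x : FP I B) : ∃ l, Red l ∧ wprod l = x := by
  classical
  refine ⟨(Word.equiv x).toList, ⟨(Word.equiv x).ne_one, (Word.equiv x).chain_ne⟩, ?_⟩
  exact Word.equiv.symm_apply_apply x

lemma nf_unique {l m : List (Σ _ : I, B)} (hl : Red l) (hm : Red m) (h : wprod l = wprod m) :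
    l = m := by
  classical
  have h' : (Word.equiv.symm ⟨l, hl.1, hl.2⟩ : FP I B) = Word.equiv.symm ⟨m, hm.1, hm.2⟩ := h
  have := Word.equiv.symm.injective h'
  exact congrArg Word.toList this

noncomputable def nf (x : FP I B) : List (Σ _ : I, B) := (exists_nf x).choose

lemma nf_red (x : FP I B) : Red (nf x) := (exists_nf x).choose_spec.1
@[simp] lemma wprod_nf (x : FP I B) : wprod (nf x) = x := (exists_nf x).choose_spec.2
lemma nf_wprod {l : List (Σ _ : I, B)} (hl : Red l) : nf (wprod l) = l :=
  nf_unique (nf_red _) hl (wprod_nf _)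

lemma nf_eq {l : List (Σ _ : I, B)} (hl : Red l) {x : FP I B} (h : wprod l = x) : nf x = l := by
  rw [← h, nf_wprod hl]

def linv (l : List (Σ _ : I, B)) : List (Σ _ : I, B) := (l.map fun a => ⟨a.1, a.2⁻¹⟩).reverse

lemma wprod_linv (l : List (Σ _ : I, B)) : wprod (linv l) = (wprod l)⁻¹ := by
  induction l with
  | nil => simp [linv]
  | cons a l ih =>
    have : linv (a :: l) = linv l ++ [⟨a.1, a.2⁻¹⟩] := by simp [linv]
    rw [this, wprod_append, ih]
    simp

lemma red_linv {l : List (Σ _ : I, B)} (hl : Red l) : Red (linv l) := by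
  refine ⟨?_, ?_⟩
  · intro a ha
    simp only [linv, List.mem_reverse, List.mem_map] at ha
    obtain ⟨b, hb, rfl⟩ := ha
    simpa using hl.1 b hb
  · rw [linv, List.isChain_reverse, List.isChain_map]
    exact hl.2.imp (fun a b h => h.symm)

lemma nf_inv (x : FP I B) : nf x⁻¹ = linv (nf x) :=
  nf_eq (red_linv (nf_red x)) (by rw [wprod_linv, wprod_nf])

def lmap (h : H) (l : List (Σ _ : I, B)) : List (Σ _ : I, B) := l.map fun a => ⟨h • a.1, a.2⟩

lemma nf_perm (h : H) (x : FP I B) : nf (permAut I B H h x) = lmap h (nf x) := by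
  apply nf_eq
  · refine ⟨?_, ?_⟩
    · intro a ha
      simp only [lmap, List.mem_map] at ha
      obtain ⟨b, hb, rfl⟩ := ha
      exact (nf_red x).1 b hb
    · rw [lmap, List.isChain_map]
      exact (nf_red x).2.imp (fun a b hab => by simpa using hab)
  · conv_rhs => rw [← wprod_nf x]
    generalize nf x = l
    induction l with
    | nil => simp [lmap]
    | cons a l ih =>
      rw [wprod_cons, map_mul, ← ih, permAut_ofi]
      simp [lmap]

/-- Length of the reduced word. -/
noncomputable def len (x : FP I B) : ℕ := (nf x).length

lemma len_inv (x : FP I B) : len x⁻¹ = len x := by simp [len, nf_inv, linv]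
lemma len_perm (h : H) (x : FP I B) : len (permAut I B H h x) = len x := by
  simp [len, nf_perm, lmap]

lemma nf_one : nf (1 : FP I B) = [] := nf_eq ⟨by simp, by simp⟩ rfl

lemma len_eq_zero {x : FP I B} (h : len x = 0) : x = 1 := by
  rw [len, List.length_eq_zero_iff] at h
  rw [← wprod_nf x, h, wprod_nil]

lemma nf_ofi (i : I) {b : B} (hb : b ≠ 1) : nf (ofi i b) = [⟨i, b⟩] :=
  nf_eq ⟨by simpa using hb, by simp⟩ (by simp)

lemma len_ofi_le (i : I) (b : B) : len (ofi i b) ≤ 1 := by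
  by_cases hb : b = 1
  · subst hb; simp [len, nf_one]
  · simp [len, nf_ofi i hb]

lemma len_inv_mul_of_ne {x y : FP I B} {i j : I} {b c : B} {l m : List (Σ _ : I, B)}
    (hx : nf x = ⟨i, b⟩ :: l) (hy : nf y = ⟨j, c⟩ :: m) (hij : i ≠ j) :
    len (x⁻¹ * y) = len x + len y := by
  have : nf (x⁻¹ * y) = linv (nf x) ++ nf y := by
    apply nf_eq
    · refine ⟨?_, ?_⟩
      · intro a ha
        rcases List.mem_append.mp ha with ha | ha
        · exact (red_linv (nf_red x)).1 a ha
        · exact (nf_red y).1 a ha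
      · apply List.IsChain.append (red_linv (nf_red x)).2 (nf_red y).2
        rw [hx, hy]
        simp [linv, hij]
    · rw [wprod_append, wprod_linv, wprod_nf, wprod_nf]
  simp [len, this, linv]

lemma len_inv_mul_of_eq {x y : FP I B} {i : I} {b c : B} {l m : List (Σ _ : I, B)}
    (hx : nf x = ⟨i, b⟩ :: l) (hy : nf y = ⟨i, c⟩ :: m) (hbc : b ≠ c) :
    len (x⁻¹ * y) + 1 = len x + len y := by
  have rx := nf_red x
  have ry := nf_red y
  have : nf (x⁻¹ * y) = linv l ++ ⟨i, b⁻¹ * c⟩ :: m := by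
    rw [hx] at rx
    rw [hy] at ry
    have rl : Red l := ⟨fun a ha => rx.1 a (List.mem_cons_of_mem _ ha), rx.2.tail⟩
    apply nf_eq
    · refine ⟨?_, ?_⟩
      · intro a ha
        rcases List.mem_append.mp ha with ha | ha
        · exact (red_linv rl).1 a ha
        · rcases List.mem_cons.mp ha with rfl | ha
          · simpa [inv_mul_eq_one] using hbc
          · exact ry.1 a (List.mem_cons_of_mem _ ha)
      · apply List.IsChain.append (red_linv rl).2
        · have := ry.2
          rw [List.isChain_cons] at this ⊢
          exact this
        · have := rx.2
          rw [List.isChain_cons] at this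
          intro a ha a' ha'
          simp only [List.head?_cons, Option.mem_some_iff] at ha'
          subst ha'
          simp only [linv, List.getLast?_reverse, List.head?_map, Option.mem_def,
            Option.map_eq_some_iff] at ha
          obtain ⟨d, hd, rfl⟩ := ha
          exact (this.1 d hd).symm
    · rw [wprod_append, wprod_linv, wprod_cons]
      conv_rhs => rw [← wprod_nf x, ← wprod_nf y, hx, hy]
      simp [mul_assoc]
  simp only [len, this, hx, hy, linv, List.length_append, List.length_reverse, List.length_map,
    List.length_cons]
  omega

/-- Conjugation shortens elements which start with `b` and end with the translate of `b⁻¹`. -/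
lemma len_conj {x : FP I B} {h : H} {i : I} {b : B} {l m : List (Σ _ : I, B)}
    (hx : nf x = ⟨i, b⟩ :: l) (hl : l ≠ [])
    (hy : nf (permAut I B H h⁻¹ x⁻¹) = ⟨i, b⟩ :: m) :
    len ((ofi i b)⁻¹ * x * permAut I B H h (ofi i b)) + 2 ≤ len x := by
  have h1 : nf x⁻¹ = ⟨h • i, b⟩ :: lmap h m := by
    have : x⁻¹ = permAut I B H h (permAut I B H h⁻¹ x⁻¹) := by
      rw [← MulAut.mul_apply, ← map_mul]; simp
    rw [this, nf_perm, hy]; rfl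
  have h2 : nf x = linv (lmap h m) ++ [⟨h • i, b⁻¹⟩] := by
    have := nf_inv x⁻¹
    rw [inv_inv, h1] at this
    rw [this]; simp [linv]
  rw [h2] at hx
  have rx := nf_red x
  rw [h2] at rx
  obtain ⟨l', hl'⟩ : ∃ l', linv (lmap h m) = ⟨i, b⟩ :: l' := by
    cases hc : linv (lmap h m) with
    | nil => rw [hc] at hx; simp at hx; exact absurd hx.2 hl
    | cons a l' =>
      rw [hc] at hx
      simp only [List.cons_append, List.cons.injEq] at hx
      exact ⟨l', by rw [hx.1]⟩
  rw [hl'] at h2 rx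
  have rl : Red l' := by
    refine ⟨fun a ha => rx.1 a (by simp [ha]), ?_⟩
    have := rx.2.tail
    exact (List.isChain_append.mp this).1
  have h3 : (ofi i b)⁻¹ * x * permAut I B H h (ofi i b) = wprod l' := by
    conv_lhs => rw [← wprod_nf x, h2]
    simp
  rw [h3]
  simp [len, nf_wprod rl, h2]

abbrev SDP (I B H : Type*) [Group B] [Group H] [MulAction H I] :=
  FP I B ⋊[permAut I B H] H

open SemidirectProduct in
theorem fixed_point (N : ℕ) : ∀ (F : Subgroup (SDP I B H)) (_ : ∀ f ∈ F, len f.left ≤ N),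
    ∃ k : FP I B, (∀ f ∈ F, ((inl k)⁻¹ * f * inl k : SDP I B H).left = 1) ∨
      ∃ i : I, ∀ f ∈ F, (∃ b, ((inl k)⁻¹ * f * inl k : SDP I B H).left = ofi i b) ∧
        ((inl k)⁻¹ * f * inl k : SDP I B H).right • i = i := by
  induction N with
  | zero =>
    intro F hF
    refine ⟨1, Or.inl fun f hf => ?_⟩
    simpa using len_eq_zero (Nat.le_zero.mp (hF f hf))
  | succ N ih =>
    intro F hF
    by_cases hall : ∀ f ∈ F, len f.left ≤ N
    · exact ih F hall
    push Not at hall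
    obtain ⟨f₀, hf₀, hlen₀⟩ := hall
    have hlen : len f₀.left = N + 1 := le_antisymm (hF f₀ hf₀) hlen₀
    obtain ⟨i, b, l₀, hl₀⟩ : ∃ i b l, nf f₀.left = ⟨i, b⟩ :: l := by
      cases hc : nf f₀.left with
      | nil => rw [len, hc] at hlen; simp at hlen
      | cons a l => exact ⟨a.1, a.2, l, rfl⟩
    -- distances between points of the orbit
    have hdist : ∀ f ∈ F, ∀ f' ∈ F, len (f.left⁻¹ * f'.left) ≤ N + 1 := by
      intro f hf f' hf'
      have := hF _ (F.mul_mem (F.inv_mem hf) hf')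
      rw [mul_left, inv_left, inv_right, ← map_mul, len_perm] at this
      exact this
    -- all nontrivial words start at `i`
    have hstart : ∀ f ∈ F, ∀ j c m, nf f.left = ⟨j, c⟩ :: m → j = i := by
      intro f hf j c m hm
      by_contra hne
      have h1 := len_inv_mul_of_ne hl₀ hm (Ne.symm hne)
      have h2 := hdist f₀ hf₀ f hf
      have h3 : len f.left = m.length + 1 := by simp [len, hm]
      omega
    -- long words start with `b`
    have hb : ∀ f ∈ F, ∀ c m, nf f.left = ⟨i, c⟩ :: m → m ≠ [] → c = b := by
      intro f hf c m hm hm'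
      by_contra hne
      have h1 := len_inv_mul_of_eq hl₀ hm (Ne.symm hne)
      have h2 := hdist f₀ hf₀ f hf
      have h3 : len f.left = m.length + 1 := by simp [len, hm]
      have h4 : m.length ≠ 0 := by simpa using hm'
      omega
    -- short elements
    have hfix0 : ∀ f ∈ F, f.left = 1 → f.right • i = i := by
      intro f hf h1
      have h2 := F.mul_mem hf hf₀
      refine hstart _ h2 (f.right • i) b (lmap f.right l₀) ?_
      rw [mul_left, h1, one_mul, nf_perm, hl₀]
      rfl
    have hfix1 : ∀ f ∈ F, ∀ c, nf f.left = [⟨i, c⟩] → f.right • i = i := by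
      intro f hf c hc
      have h2 := F.inv_mem hf
      have h3 : nf f⁻¹.left = [⟨f.right⁻¹ • i, c⁻¹⟩] := by
        rw [inv_left, nf_perm, nf_inv, hc]
        simp [linv, lmap]
      have := hstart _ h2 _ _ _ h3
      rw [inv_smul_eq_iff] at this
      exact this.symm
    rcases Nat.eq_zero_or_pos N with rfl | hN
    · refine ⟨1, Or.inr ⟨i, fun f hf => ?_⟩⟩
      simp only [map_one, inv_one, one_mul, mul_one]
      cases hc : nf f.left with
      | nil =>
        have h1 : f.left = 1 := by rw [← wprod_nf f.left, hc]; rfl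
        exact ⟨⟨1, by rw [h1, map_one]⟩, hfix0 f hf h1⟩
      | cons a m =>
        have h1 := hF f hf
        have hm : m = [] := by
          rw [len, hc] at h1
          simpa using h1
        subst hm
        obtain ⟨j, c⟩ := a
        have hj : j = i := hstart f hf _ _ _ hc
        subst hj
        refine ⟨⟨c, ?_⟩, hfix1 f hf c hc⟩
        rw [← wprod_nf f.left, hc]; simp
    · let g : SDP I B H := inl (ofi i b)
      have hconj : ∀ f : SDP I B H, (g⁻¹ * f * g).left =
          (ofi i b)⁻¹ * f.left * permAut I B H f.right (ofi i b) := by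
        intro f
        simp [g, mul_left, inv_left, inv_right, mul_assoc]
      have hshort : ∀ f ∈ F, len (g⁻¹ * f * g).left ≤ N := by
        intro f hf
        rw [hconj]
        cases hc : nf f.left with
        | nil =>
          have h1 : f.left = 1 := by rw [← wprod_nf f.left, hc]; rfl
          rw [h1, permAut_ofi, hfix0 f hf h1]
          simp [len, nf_one]
        | cons a m =>
          obtain ⟨j, c⟩ := a
          have hj : j = i := hstart f hf _ _ _ hc
          subst hj
          by_cases hm : m = []
          · subst hm
            have h1 : f.left = ofi j c := by rw [← wprod_nf f.left, hc]; simp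
            rw [h1, permAut_ofi, hfix1 f hf c hc, ← map_inv, ← map_mul, ← map_mul]
            exact (len_ofi_le _ _).trans hN
          · have hcb := hb f hf _ _ hc hm
            subst hcb
            have hfi := F.inv_mem hf
            have hli : len f⁻¹.left = len f.left := by rw [inv_left, len_perm, len_inv]
            have hml : len f.left = m.length + 1 := by simp [len, hc]
            have hm0 : m.length ≠ 0 := by simpa using hm
            cases hd : nf f⁻¹.left with
            | nil => rw [← hli, len, hd] at hml; simp at hml
            | cons a m' =>
              obtain ⟨j', c'⟩ := a
              have hj' := hstart _ hfi _ _ _ hd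
              subst hj'
              have hm' : m' ≠ [] := by
                rintro rfl
                rw [← hli, len, hd] at hml
                simp at hml
                exact hm hml
              have hcb' := hb _ hfi _ _ hd hm'
              subst hcb'
              have := len_conj (h := f.right) hc hm (by rw [← inv_left]; exact hd)
              have := hF f hf
              omega
      obtain ⟨k, hk⟩ := ih (F.map (MulAut.conj g⁻¹).toMonoidHom) (by
        rintro _ ⟨f, hf, rfl⟩
        simpa using hshort f hf)
      have hcc : ∀ f : SDP I B H, (inl (ofi i b * k))⁻¹ * f * inl (ofi i b * k) =
          (inl k)⁻¹ * ((MulAut.conj g⁻¹).toMonoidHom f) * inl k := by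
        intro f
        simp [g, mul_assoc]
      refine ⟨ofi i b * k, ?_⟩
      rcases hk with hk | ⟨i', hk⟩
      · left
        intro f hf
        rw [hcc]
        exact hk _ ⟨f, hf, rfl⟩
      · right
        refine ⟨i', fun f hf => ?_⟩
        rw [hcc]
        exact hk _ ⟨f, hf, rfl⟩

end FixedPoint

end GPRigid


namespace GPRigid

section GraphProd

universe u v w

variable {V : Type u} {Γ : SimpleGraph V} {G : V → Type v} [∀ v, Group (G v)]

lemma of_commute {a b : V} (h : Γ.Adj a b) (x : G a) (y : G b) :
    GraphProduct.of Γ G a x * GraphProduct.of Γ G b y =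
      GraphProduct.of Γ G b y * GraphProduct.of Γ G a x := by
  have h1 : (QuotientGroup.mk' (Subgroup.normalClosure (graphProdRels Γ G)))
      ((CoprodI.of x)⁻¹ * (CoprodI.of y)⁻¹ * CoprodI.of x * CoprodI.of y) = 1 := by
    rw [← MonoidHom.mem_ker, QuotientGroup.ker_mk']
    exact Subgroup.subset_normalClosure ⟨a, b, h, x, y, rfl⟩
  rw [map_mul, map_mul, map_mul, map_inv, map_inv] at h1
  have h2 : (GraphProduct.of Γ G a x)⁻¹ * (GraphProduct.of Γ G b y)⁻¹ *
    GraphProduct.of Γ G a x * GraphProduct.of Γ G b y = 1 := h1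
  have h3 : GraphProduct.of Γ G b y * GraphProduct.of Γ G a x *
      ((GraphProduct.of Γ G a x)⁻¹ * (GraphProduct.of Γ G b y)⁻¹ *
    GraphProduct.of Γ G a x * GraphProduct.of Γ G b y) = GraphProduct.of Γ G b y * GraphProduct.of Γ G a x := by
    rw [h2, mul_one]
  rw [← h3]
  group

/-- The universal property of graph products. -/
def glift (Γ : SimpleGraph V) {N : Type w} [Group N] (f : ∀ v, G v →* N)
    (hf : ∀ a b, Γ.Adj a b → ∀ x y, f a x * f b y = f b y * f a x) : GraphProduct Γ G →* N :=
  QuotientGroup.lift (Subgroup.normalClosure (graphProdRels Γ G)) (CoprodI.lift f) (by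
    intro x hx
    revert x
    show Subgroup.normalClosure (graphProdRels Γ G) ≤ (CoprodI.lift f).ker
    apply Subgroup.normalClosure_le_normal
    rintro _ ⟨a, b, hab, x, y, rfl⟩
    show _ ∈ (CoprodI.lift f).ker
    rw [MonoidHom.mem_ker]
    simp only [map_mul, map_inv, CoprodI.lift_of]
    rw [mul_assoc, hf a b hab x y]
    group)

@[simp] lemma glift_of {N : Type w} [Group N] (f : ∀ v, G v →* N)
    (hf : ∀ a b, Γ.Adj a b → ∀ x y, f a x * f b y = f b y * f a x) (a : V) (x : G a) :
    glift Γ f hf (GraphProduct.of Γ G a x) = f a x := by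
  show CoprodI.lift f (CoprodI.of x) = f a x
  simp

lemma ghom_ext {N : Type w} [Group N] {f g : GraphProduct Γ G →* N}
    (h : ∀ a x, f (GraphProduct.of Γ G a x) = g (GraphProduct.of Γ G a x)) : f = g := by
  apply QuotientGroup.monoidHom_ext
  apply CoprodI.ext_hom
  intro a
  ext x
  exact h a x

lemma of_mem_vsub {A : Set V} {a : V} (ha : a ∈ A) (x : G a) :
    GraphProduct.of Γ G a x ∈ GraphProduct.vsub Γ G A :=
  (le_iSup₂_of_le (f := fun (a : V) (_ : a ∈ A) => (GraphProduct.of Γ G a).range) a ha le_rfl :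
    (GraphProduct.of Γ G a).range ≤ _) ⟨x, rfl⟩

lemma vsub_le {A : Set V} {S : Subgroup (GraphProduct Γ G)}
    (h : ∀ a ∈ A, ∀ x, GraphProduct.of Γ G a x ∈ S) : GraphProduct.vsub Γ G A ≤ S := by
  refine iSup₂_le fun a ha => ?_
  rintro _ ⟨x, rfl⟩
  exact h a ha x

lemma vsub_mono {A A' : Set V} (h : A ⊆ A') :
    GraphProduct.vsub Γ G A ≤ GraphProduct.vsub Γ G A' :=
  vsub_le fun _ ha x => of_mem_vsub (h ha) x

open Classical in
/-- The retraction onto `G(A)`, as an endomorphism. -/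
noncomputable def retr (Γ : SimpleGraph V) (G : V → Type v) [∀ v, Group (G v)] (A : Set V) :
    GraphProduct Γ G →* GraphProduct Γ G :=
  glift Γ (fun a => if a ∈ A then GraphProduct.of Γ G a else 1) (by
    intro a b hab x y
    by_cases ha : a ∈ A <;> by_cases hb : b ∈ A <;> simp [ha, hb, of_commute hab])

lemma retr_of_mem {A : Set V} {a : V} (ha : a ∈ A) (x : G a) :
    retr Γ G A (GraphProduct.of Γ G a x) = GraphProduct.of Γ G a x := by
  simp [retr, ha]

lemma retr_of_not_mem {A : Set V} {a : V} (ha : a ∉ A) (x : G a) :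
    retr Γ G A (GraphProduct.of Γ G a x) = 1 := by
  simp [retr, ha]

lemma retr_eq_self {A : Set V} {g : GraphProduct Γ G} (hg : g ∈ GraphProduct.vsub Γ G A) :
    retr Γ G A g = g := by
  have : GraphProduct.vsub Γ G A ≤ (retr Γ G A).eqLocus (MonoidHom.id _) :=
    vsub_le fun a ha x => retr_of_mem ha x
  exact this hg

lemma vsub_univ (g : GraphProduct Γ G) : g ∈ GraphProduct.vsub Γ G Set.univ := by
  let f : GraphProduct Γ G →* GraphProduct.vsub Γ G Set.univ :=
    glift Γ (fun a => (GraphProduct.of Γ G a).codRestrict _ fun x => of_mem_vsub (Set.mem_univ a) x)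
      (by intro a b hab x y; ext; exact of_commute hab x y)
  have : (Subgroup.subtype _).comp f = MonoidHom.id _ := by
    apply ghom_ext
    intro a x
    simp [f]
  rw [← MonoidHom.id_apply (GraphProduct Γ G) g, ← this]
  exact (f g).2

lemma retr_mem_inter {A D : Set V} {g : GraphProduct Γ G} (hg : g ∈ GraphProduct.vsub Γ G D) :
    retr Γ G A g ∈ GraphProduct.vsub Γ G (D ∩ A) := by
  have : GraphProduct.vsub Γ G D ≤ (GraphProduct.vsub Γ G (D ∩ A)).comap (retr Γ G A) := by
    refine vsub_le fun a ha x => ?_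
    rw [Subgroup.mem_comap]
    by_cases h : a ∈ A
    · rw [retr_of_mem h]; exact of_mem_vsub (show a ∈ D ∩ A from ⟨ha, h⟩) x
    · rw [retr_of_not_mem h]; exact one_mem _
  exact this hg

lemma retr_mem {A : Set V} (g : GraphProduct Γ G) : retr Γ G A g ∈ GraphProduct.vsub Γ G A :=
  vsub_mono Set.inter_subset_right (retr_mem_inter (vsub_univ g))

section Decomp

variable (Γ G) (v₀ : V)

/-- The graph with one vertex removed. -/
abbrev delG : SimpleGraph {a : V // a ≠ v₀} := Γ.comap (fun a => a.1)

abbrev HG := GraphProduct (delG Γ v₀) (fun a : {a : V // a ≠ v₀} => G a.1)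

/-- The subgroup of `HG` of the link of the removed vertex. -/
abbrev lk : Set {a : V // a ≠ v₀} := {a | Γ.Adj a.1 v₀}

abbrev LG : Subgroup (HG Γ G v₀) := GraphProduct.vsub _ _ (lk Γ v₀)

/-- The inclusion of the graph product with one vertex removed. -/
def incl : HG Γ G v₀ →* GraphProduct Γ G :=
  glift _ (fun a => GraphProduct.of Γ G a.1) (fun _ _ hab x y => of_commute (Γ := Γ) hab x y)

abbrev QG := SDP (HG Γ G v₀ ⧸ LG Γ G v₀) (G v₀) (HG Γ G v₀)

variable {Γ G v₀}

lemma incl_of (a : {a : V // a ≠ v₀}) (x : G a.1) :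
    incl Γ G v₀ (GraphProduct.of _ _ a x) = GraphProduct.of Γ G a.1 x := by
  simp [incl]

lemma incl_mem {D : Set {a : V // a ≠ v₀}} {g : HG Γ G v₀} (hg : g ∈ GraphProduct.vsub _ _ D) :
    incl Γ G v₀ g ∈ GraphProduct.vsub Γ G (Subtype.val '' D) := by
  have : GraphProduct.vsub _ _ D ≤
      (GraphProduct.vsub Γ G (Subtype.val '' D)).comap (incl Γ G v₀) := by
    refine vsub_le fun a ha x => ?_
    rw [Subgroup.mem_comap, incl_of]
    exact of_mem_vsub (A := Subtype.val '' D) ⟨a, ha, rfl⟩ x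
  exact this hg

lemma incl_commute {l : HG Γ G v₀} (hl : l ∈ LG Γ G v₀) (b : G v₀) :
    incl Γ G v₀ l * GraphProduct.of Γ G v₀ b = GraphProduct.of Γ G v₀ b * incl Γ G v₀ l := by
  have : LG Γ G v₀ ≤
      (Subgroup.centralizer {GraphProduct.of Γ G v₀ b}).comap (incl Γ G v₀) := by
    refine vsub_le fun a ha x => ?_
    rw [Subgroup.mem_comap, incl_of, Subgroup.mem_centralizer_singleton_iff]
    exact of_commute ha x b
  have := this hl
  rw [Subgroup.mem_comap, Subgroup.mem_centralizer_singleton_iff] at this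
  exact this

open SemidirectProduct

variable (Γ G v₀)

/-- The homomorphism to the semidirect product on a vertex group. -/
noncomputable def phiV (a : V) : G a →* QG Γ G v₀ := by
  classical
  exact if h : a = v₀ then
    (inl.comp ((ofi (((1 : HG Γ G v₀) : HG Γ G v₀ ⧸ LG Γ G v₀)) : G v₀ →* _))).comp
      (h ▸ MonoidHom.id (G a))
  else inr.comp (GraphProduct.of (delG Γ v₀) (fun a : {a : V // a ≠ v₀} => G a.1) ⟨a, h⟩)

lemma phiV_same (b : G v₀) : phiV Γ G v₀ v₀ b =
    inl (ofi (((1 : HG Γ G v₀) : HG Γ G v₀ ⧸ LG Γ G v₀)) b) := by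
  simp [phiV]

lemma phiV_ne {a : V} (h : a ≠ v₀) (b : G a) : phiV Γ G v₀ a b =
    inr (GraphProduct.of (delG Γ v₀) (fun a : {a : V // a ≠ v₀} => G a.1) ⟨a, h⟩ b) := by
  simp [phiV, h]

lemma phi_comm_aux {a : V} (h : Γ.Adj a v₀) (x : G a) (b : G v₀) :
    phiV Γ G v₀ a x * phiV Γ G v₀ v₀ b = phiV Γ G v₀ v₀ b * phiV Γ G v₀ a x := by
  rw [phiV_same, phiV_ne Γ G v₀ h.ne]
  set l := GraphProduct.of (delG Γ v₀) (fun a : {a : V // a ≠ v₀} => G a.1) ⟨a, h.ne⟩ x with hl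
  have hmem : l ∈ LG Γ G v₀ := 
    of_mem_vsub (Γ := delG Γ v₀) (G := fun a : {a : V // a ≠ v₀} => G a.1) (A := lk Γ v₀)
      (a := ⟨a, h.ne⟩) h x
  ext
  · simp only [mul_left, left_inr, right_inr, left_inl, right_inl, one_mul, permAut_ofi, map_one,
      mul_one]
    congr 2
    rw [MulAction.Quotient.smul_coe, smul_eq_mul, mul_one]
    exact QuotientGroup.eq.mpr (by simpa using hmem)
  · simp

noncomputable def phi : GraphProduct Γ G →* QG Γ G v₀ :=
  glift Γ (phiV Γ G v₀) (by
    intro a c hac x y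
    by_cases ha : a = v₀
    · subst ha
      exact (phi_comm_aux Γ G a hac.symm y x).symm
    · by_cases hc : c = v₀
      · subst hc
        exact phi_comm_aux Γ G c hac x y
      · rw [phiV_ne Γ G v₀ ha, phiV_ne Γ G v₀ hc, ← map_mul, ← map_mul]
        congr 1
        exact of_commute (Γ := delG Γ v₀) (G := fun a : {a : V // a ≠ v₀} => G a.1)
          (a := ⟨a, ha⟩) (b := ⟨c, hc⟩) hac x y)

/-- Conjugates of the removed vertex group, indexed by cosets. -/
noncomputable def psiC (i : HG Γ G v₀ ⧸ LG Γ G v₀) : G v₀ →* GraphProduct Γ G :=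
  (MulAut.conj (incl Γ G v₀ i.out)).toMonoidHom.comp (GraphProduct.of Γ G v₀)

lemma psiC_mk (x : HG Γ G v₀) (b : G v₀) :
    psiC Γ G v₀ (x : HG Γ G v₀ ⧸ LG Γ G v₀) b =
      incl Γ G v₀ x * GraphProduct.of Γ G v₀ b * (incl Γ G v₀ x)⁻¹ := by
  obtain ⟨l, hl⟩ := QuotientGroup.mk_out_eq_mul (LG Γ G v₀) x
  simp only [psiC, MonoidHom.comp_apply, MulEquiv.coe_toMonoidHom, MulAut.conj_apply]
  rw [hl, map_mul, mul_assoc (incl Γ G v₀ x), incl_commute l.2]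
  group

noncomputable def psi : QG Γ G v₀ →* GraphProduct Γ G :=
  SemidirectProduct.lift (CoprodI.lift (psiC Γ G v₀)) (incl Γ G v₀) (by
    intro h
    apply CoprodI.ext_hom
    intro i
    ext b
    obtain ⟨x, rfl⟩ := QuotientGroup.mk_surjective i
    have h1 : permAut (HG Γ G v₀ ⧸ LG Γ G v₀) (G v₀) (HG Γ G v₀) h
      (CoprodI.of (M := fun _ : HG Γ G v₀ ⧸ LG Γ G v₀ => G v₀)
        (i := (x : HG Γ G v₀ ⧸ LG Γ G v₀)) b) =
      ofi ((h * x : HG Γ G v₀) : HG Γ G v₀ ⧸ LG Γ G v₀) b := permAut_ofi _ _ _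
    simp only [MonoidHom.comp_apply, MulEquiv.coe_toMonoidHom, MulAut.conj_apply]
    rw [h1, CoprodI.lift_of, CoprodI.lift_of, psiC_mk, psiC_mk, map_mul]
    group)

lemma psi_inr (h : HG Γ G v₀) : psi Γ G v₀ (inr h) = incl Γ G v₀ h := by
  simp [psi]

lemma psi_inl_ofi (x : HG Γ G v₀) (b : G v₀) :
    psi Γ G v₀ (inl (ofi (x : HG Γ G v₀ ⧸ LG Γ G v₀) b)) =
      incl Γ G v₀ x * GraphProduct.of Γ G v₀ b * (incl Γ G v₀ x)⁻¹ := by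
  simp [psi, psiC_mk]

lemma psi_phi (g : GraphProduct Γ G) : psi Γ G v₀ (phi Γ G v₀ g) = g := by
  have : (psi Γ G v₀).comp (phi Γ G v₀) = MonoidHom.id _ := by
    apply ghom_ext
    intro a x
    simp only [MonoidHom.comp_apply, phi, glift_of, MonoidHom.id_apply]
    by_cases h : a = v₀
    · subst h
      rw [phiV_same, psi_inl_ofi]
      simp
    · rw [phiV_ne Γ G v₀ h, psi_inr, incl_of]
  exact DFunLike.congr_fun this g

end Decomp


theorem finite_conj (n : ℕ) : ∀ {V : Type u} [Finite V] (_ : Nat.card V = n) (Γ : SimpleGraph V)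
    (G : V → Type v) [∀ v, Group (G v)] (F : Subgroup (GraphProduct Γ G)) (_ : Finite F),
    ∃ (g : GraphProduct Γ G) (D : Set V), Γ.IsClique D ∧
      ∀ f ∈ F, g⁻¹ * f * g ∈ GraphProduct.vsub Γ G D := by
  induction n with
  | zero =>
    intro V _ hV Γ G _ F hF
    have : IsEmpty V := (Finite.card_eq_zero_iff).mp hV
    refine ⟨1, ∅, by simp, fun f hf => ?_⟩
    simpa [Set.eq_empty_of_isEmpty] using vsub_univ f
  | succ n ih =>
    intro V _ hV Γ G _ F hF
    have : Nonempty V := by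
      by_contra h
      rw [not_nonempty_iff] at h
      simp at hV
    obtain ⟨v₀⟩ := this
    have hcard : Nat.card {a : V // a ≠ v₀} = n := by
      classical
      have := Nat.card_congr (Equiv.optionSubtypeNe v₀)
      rw [Finite.card_option] at this
      omega
    let F₁ := F.map (phi Γ G v₀)
    have hF₁ : Finite F₁ := (Set.toFinite (F : Set (GraphProduct Γ G))).image (phi Γ G v₀)
    obtain ⟨N, hN⟩ : ∃ N, ∀ f ∈ F₁, len f.left ≤ N := by
      have := ((Set.toFinite (F₁ : Set (QG Γ G v₀))).image (fun f => len f.left)).bddAbove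
      obtain ⟨N, hN⟩ := this
      exact ⟨N, fun f hf => hN ⟨f, hf, rfl⟩⟩
    obtain ⟨k, hk⟩ := fixed_point N F₁ hN
    let c : QG Γ G v₀ := SemidirectProduct.inl k
    rcases hk with hk | ⟨i, hk⟩
    · let F₂ : Subgroup (HG Γ G v₀) :=
        (F₁.map (MulAut.conj c⁻¹).toMonoidHom).map SemidirectProduct.rightHom
      have hF₂ : Finite F₂ := ((Set.toFinite (F₁ : Set (QG Γ G v₀))).image _).image _
      obtain ⟨g, D, hD, hg⟩ := ih hcard (delG Γ v₀) (fun a => G a.1) F₂ hF₂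
      refine ⟨psi Γ G v₀ c * incl Γ G v₀ g, Subtype.val '' D, ?_, ?_⟩
      · rintro _ ⟨a, ha, rfl⟩ _ ⟨b, hb, rfl⟩ hab
        exact hD ha hb (fun h => hab (congrArg _ h))
      · intro f hf
        have hf1 : phi Γ G v₀ f ∈ F₁ := ⟨f, hf, rfl⟩
        have h1 := hk _ hf1
        set q : QG Γ G v₀ := c⁻¹ * phi Γ G v₀ f * c with hq
        have h2 : q.right ∈ F₂ := ⟨q, ⟨_, hf1, by simp [hq]⟩, rfl⟩
        have h3 := incl_mem (hg _ h2)
        have h4 : q = SemidirectProduct.inr q.right := by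
          ext
          · simpa using h1
          · simp
        have h5 : incl Γ G v₀ q.right = (psi Γ G v₀ c)⁻¹ * f * psi Γ G v₀ c := by
          rw [← psi_inr, ← h4, hq, map_mul, map_mul, map_inv, psi_phi]
        rw [map_mul, map_mul, map_inv, h5] at h3
        convert h3 using 1
        group
    · obtain ⟨y, rfl⟩ := QuotientGroup.mk_surjective i
      let F₂ : Subgroup (HG Γ G v₀) :=
        (F₁.map (MulAut.conj (c * SemidirectProduct.inr y)⁻¹).toMonoidHom).map
          SemidirectProduct.rightHom
      have hF₂ : Finite F₂ := ((Set.toFinite (F₁ : Set (QG Γ G v₀))).image _).image _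
      obtain ⟨g, D, hD, hg⟩ := ih hcard (delG Γ v₀) (fun a => G a.1) F₂ hF₂
      set ρ := retr (delG Γ v₀) (fun a => G a.1) (lk Γ v₀) with hρ
      refine ⟨psi Γ G v₀ c * incl Γ G v₀ y * incl Γ G v₀ (ρ g),
        insert v₀ (Subtype.val '' (D ∩ lk Γ v₀)), ?_, ?_⟩
      · rw [SimpleGraph.isClique_insert]
        refine ⟨?_, ?_⟩
        · rintro _ ⟨a, ha, rfl⟩ _ ⟨b, hb, rfl⟩ hab
          exact hD ha.1 hb.1 (fun h => hab (congrArg _ h))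
        · rintro _ ⟨a, ha, rfl⟩ _
          exact ha.2.symm
      · intro f hf
        have hf1 : phi Γ G v₀ f ∈ F₁ := ⟨f, hf, rfl⟩
        obtain ⟨⟨b, h1⟩, h1'⟩ := hk _ hf1
        set q : QG Γ G v₀ := c⁻¹ * phi Γ G v₀ f * c with hq
        change q.left = _ at h1
        change q.right • _ = _ at h1'
        have h2 : y⁻¹ * q.right * y ∈ F₂ := ⟨_, ⟨_, hf1, rfl⟩, by simp [hq, mul_assoc]⟩
        set l := y⁻¹ * q.right * y with hl
        have hlL : l ∈ LG Γ G v₀ := by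
          rw [MulAction.Quotient.smul_coe, smul_eq_mul, eq_comm, QuotientGroup.eq] at h1'
          rw [hl, mul_assoc]; exact h1'
        have h3 := retr_mem_inter (A := lk Γ v₀) (hg _ h2)
        rw [← hρ, map_mul, map_mul, map_inv, hρ, retr_eq_self hlL, ← hρ] at h3
        have h3' := incl_mem h3
        rw [map_mul, map_mul, map_inv] at h3'
        have hρL : ρ g ∈ LG Γ G v₀ := retr_mem g
        have h4 : q = SemidirectProduct.inl q.left * SemidirectProduct.inr q.right := by
          rw [SemidirectProduct.inl_left_mul_inr_right]
        have h5 : (psi Γ G v₀ c)⁻¹ * f * psi Γ G v₀ c =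
            incl Γ G v₀ y * GraphProduct.of Γ G v₀ b * (incl Γ G v₀ y)⁻¹ *
              incl Γ G v₀ q.right := by
          rw [← psi_inl_ofi, ← psi_inr, ← h1, ← map_mul, ← h4, hq, map_mul, map_mul, map_inv,
            psi_phi]
        have h6 : (psi Γ G v₀ c * incl Γ G v₀ y * incl Γ G v₀ (ρ g))⁻¹ * f *
            (psi Γ G v₀ c * incl Γ G v₀ y * incl Γ G v₀ (ρ g)) =
            GraphProduct.of Γ G v₀ b *
              ((incl Γ G v₀ (ρ g))⁻¹ * incl Γ G v₀ l * incl Γ G v₀ (ρ g)) := by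
          have h7 : (incl Γ G v₀ (ρ g))⁻¹ * GraphProduct.of Γ G v₀ b =
              GraphProduct.of Γ G v₀ b * (incl Γ G v₀ (ρ g))⁻¹ := by
            rw [← map_inv]
            exact incl_commute (inv_mem hρL) b
          calc _ = (incl Γ G v₀ (ρ g))⁻¹ * (incl Γ G v₀ y)⁻¹ *
                ((psi Γ G v₀ c)⁻¹ * f * psi Γ G v₀ c) * incl Γ G v₀ y * incl Γ G v₀ (ρ g) := by
                group
            _ = ((incl Γ G v₀ (ρ g))⁻¹ * GraphProduct.of Γ G v₀ b) *
                ((incl Γ G v₀ y)⁻¹ * incl Γ G v₀ q.right * incl Γ G v₀ y) *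
                  incl Γ G v₀ (ρ g) := by
                rw [h5]; group
            _ = _ := by
                rw [h7, hl, map_mul, map_mul, map_inv]; group
        rw [h6]
        refine mul_mem (of_mem_vsub (Set.mem_insert _ _) b) ?_
        exact vsub_mono (Set.subset_insert _ _) h3'

end GraphProd

end GPRigid


namespace GPRigid

section Final

universe u v u' v' w

section Basic

variable {V : Type u} {Γ : SimpleGraph V} {G : V → Type v} [∀ v, Group (G v)]

open Classical in
lemma prj_aux : ∀ a b, Γ.Adj a b → ∀ (x : G a) (y : G b),
    MonoidHom.mulSingle G a x * MonoidHom.mulSingle G b y =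
      MonoidHom.mulSingle G b y * MonoidHom.mulSingle G a x :=
  fun _ _ hab x y => (Pi.mulSingle_commute hab.ne x y).eq

open Classical in
/-- The projection to the direct product. -/
noncomputable def prj (Γ : SimpleGraph V) (G : V → Type v) [∀ v, Group (G v)] :
    GraphProduct Γ G →* ∀ v, G v :=
  glift Γ (fun v => MonoidHom.mulSingle G v)
    prj_aux

lemma prj_of_same (a : V) (x : G a) : prj Γ G (GraphProduct.of Γ G a x) a = x := by
  classical
  rw [prj, glift_of]; simp

lemma prj_of_ne {a b : V} (h : b ≠ a) (x : G a) : prj Γ G (GraphProduct.of Γ G a x) b = 1 := by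
  classical
  rw [prj, glift_of]; simp [Pi.mulSingle_eq_of_ne h]

lemma prj_vsub {A : Set V} {g : GraphProduct Γ G} (hg : g ∈ GraphProduct.vsub Γ G A) {b : V}
    (hb : b ∉ A) : prj Γ G g b = 1 := by
  have : GraphProduct.vsub Γ G A ≤ ((Pi.evalMonoidHom G b).comp (prj Γ G)).ker := by
    refine vsub_le fun a ha x => ?_
    rw [MonoidHom.mem_ker]
    exact prj_of_ne (Γ := Γ) (b := b) (a := a) (by rintro rfl; exact hb ha) x
  exact this hg

variable [Finite V]

lemma cliq_aux {A : Set V} (hA : Γ.IsClique A) : Pairwise fun a b : A => ∀ (x : G a) (y : G b),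
    Commute (GraphProduct.of Γ G a x) (GraphProduct.of Γ G b y) := by
  intro a b hab x y
  exact of_commute (hA a.2 b.2 (fun h => hab (Subtype.ext h))) x y

open Classical in
/-- The direct product of the vertex groups of a clique. -/
noncomputable def cliq {A : Set V} (hA : Γ.IsClique A) : (∀ a : A, G a) →* GraphProduct Γ G :=
  letI : Fintype A := Fintype.ofFinite A
  MonoidHom.noncommPiCoprod (fun a : A => GraphProduct.of Γ G a.1)
    (cliq_aux hA)

open Classical in
lemma cliq_single {A : Set V} (hA : Γ.IsClique A) (a : A) (x : G a) :
    cliq hA (Pi.mulSingle a x) = GraphProduct.of Γ G a.1 x := by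
  simp [cliq]

lemma cliq_range {A : Set V} (hA : Γ.IsClique A) :
    (cliq (G := G) hA).range = GraphProduct.vsub Γ G A := by
  rw [cliq, MonoidHom.noncommPiCoprod_range, GraphProduct.vsub, iSup_subtype']

lemma prj_cliq {A : Set V} (hA : Γ.IsClique A) (x : ∀ a : A, G a) (a : A) :
    prj Γ G (cliq hA x) a.1 = x a := by
  classical
  have : ((Pi.evalMonoidHom G a.1).comp (prj Γ G)).comp (cliq hA) =
      Pi.evalMonoidHom (fun a : A => G a) a := by
    refine MonoidHom.pi_ext fun b y => ?_
    simp only [MonoidHom.comp_apply, cliq_single, Pi.evalMonoidHom_apply]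
    by_cases h : a = b
    · subst h
      rw [prj_of_same, Pi.mulSingle_eq_same]
    · rw [prj_of_ne (fun h' => h (Subtype.ext h')), Pi.mulSingle_eq_of_ne h]
  exact DFunLike.congr_fun this x

lemma prj_inj {A : Set V} (hA : Γ.IsClique A) {g : GraphProduct Γ G}
    (hg : g ∈ GraphProduct.vsub Γ G A) (h : prj Γ G g = 1) : g = 1 := by
  rw [← cliq_range hA] at hg
  obtain ⟨x, rfl⟩ := hg
  have : x = 1 := by
    ext a
    rw [← prj_cliq hA x a, h]; rfl
  rw [this, map_one]

lemma cliq_injective {A : Set V} (hA : Γ.IsClique A) :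
    Function.Injective (cliq (G := G) hA) := by
  intro x y h
  ext a
  rw [← prj_cliq hA x a, h, prj_cliq]

lemma finite_vsub [∀ v, Finite (G v)] {A : Set V} (hA : Γ.IsClique A) :
    Finite (GraphProduct.vsub Γ G A) := by
  rw [← cliq_range hA]
  exact Set.finite_range (cliq (G := G) hA)

end Basic

variable {V : Type u} {Γ : SimpleGraph V} {G : V → Type v} [∀ v, Group (G v)] [Finite V]
  [∀ v, Finite (G v)]
variable {V' : Type u'} {Γ' : SimpleGraph V'} {G' : V' → Type v'} [∀ v, Group (G' v)] [Finite V']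
  [∀ v, Finite (G' v)]

def Rel (φ : GraphProduct Γ G ≃* GraphProduct Γ' G') (C : Set V) (C' : Set V') : Prop :=
  ∃ g, ∀ x ∈ GraphProduct.vsub Γ G C, g⁻¹ * φ x * g ∈ GraphProduct.vsub Γ' G' C'

lemma Rel.prj {φ : GraphProduct Γ G ≃* GraphProduct Γ' G'} {C : Set V} {C' : Set V'}
    (h : Rel φ C C') {x : GraphProduct Γ G} (hx : x ∈ GraphProduct.vsub Γ G C) {b : V'}
    (hb : b ∉ C') : prj Γ' G' (φ x) b = 1 := by
  obtain ⟨g, hg⟩ := h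
  have := prj_vsub (hg x hx) hb
  rw [map_mul, map_mul, map_inv, Pi.mul_apply, Pi.mul_apply, Pi.inv_apply] at this
  have h2 : GPRigid.prj Γ' G' g b * ((GPRigid.prj Γ' G' g b)⁻¹ * GPRigid.prj Γ' G' (φ x) b *
    GPRigid.prj Γ' G' g b) * (GPRigid.prj Γ' G' g b)⁻¹ = 1 := by rw [this]; simp
  rw [← h2]; group

lemma rel_exists (φ : GraphProduct Γ G ≃* GraphProduct Γ' G') {C : Set V} (hC : Γ.IsClique C) :
    ∃ C', Maximal Γ'.IsClique C' ∧ Rel φ C C' := by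
  have hfin := finite_vsub (G := G) hC
  obtain ⟨g, D, hD, hg⟩ := finite_conj _ rfl Γ' G'
    ((GraphProduct.vsub Γ G C).map φ.toMonoidHom)
    ((Set.toFinite (GraphProduct.vsub Γ G C : Set (GraphProduct Γ G))).image φ)
  obtain ⟨C', hDC, hC'⟩ := Finite.exists_le_maximal hD
  exact ⟨C', hC', g, fun x hx => vsub_mono hDC (hg _ ⟨x, hx, rfl⟩)⟩

lemma rel_back {φ : GraphProduct Γ G ≃* GraphProduct Γ' G'} {C C'' : Set V} {C' : Set V'}
    (hG : ∀ v, Nontrivial (G v)) (h : Rel φ C C') (h' : Rel φ.symm C' C'') : C ⊆ C'' := by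
  intro a ha
  by_contra hn
  obtain ⟨x, hx⟩ := exists_ne (1 : G a)
  obtain ⟨g, hg⟩ := h
  have h1 := h'.prj (hg _ (of_mem_vsub ha x)) hn
  have h0 : ∀ y, φ.symm (g⁻¹ * φ y * g) = (φ.symm g)⁻¹ * y * φ.symm g := fun y => by simp
  rw [h0, map_mul, map_mul, map_inv, Pi.mul_apply, Pi.mul_apply, Pi.inv_apply, prj_of_same] at h1
  apply hx
  have h2 : GPRigid.prj Γ G (φ.symm g) a * ((GPRigid.prj Γ G (φ.symm g) a)⁻¹ * x *
    GPRigid.prj Γ G (φ.symm g) a) * (GPRigid.prj Γ G (φ.symm g) a)⁻¹ = 1 := by rw [h1]; simp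
  rw [← h2]; group

lemma exists_sigma (φ : GraphProduct Γ G ≃* GraphProduct Γ' G') (hG : ∀ v, Nontrivial (G v))
    (hG' : ∀ v, Nontrivial (G' v)) :
    ∃ σ : {C // Maximal Γ.IsClique C} ≃ {C // Maximal Γ'.IsClique C},
      ∀ C, Rel φ C.1 (σ C).1 ∧ Rel φ.symm (σ C).1 C.1 := by
  choose f hf1 hf2 using fun C : {C // Maximal Γ.IsClique C} => rel_exists φ C.2.1
  choose g hg1 hg2 using fun C : {C // Maximal Γ'.IsClique C} => rel_exists φ.symm C.2.1
  have h1 : ∀ C, g ⟨f C, hf1 C⟩ = C.1 := by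
    intro C
    have := rel_back hG (hf2 C) (hg2 ⟨f C, hf1 C⟩)
    exact (C.2.eq_of_subset (hg1 _).1 this).symm
  have h2 : ∀ C, f ⟨g C, hg1 C⟩ = C.1 := by
    intro C
    have := rel_back (φ := φ.symm) hG' (hg2 C) (hf2 ⟨g C, hg1 C⟩)
    exact (C.2.eq_of_subset (hf1 _).1 this).symm
  refine ⟨⟨fun C => ⟨f C, hf1 C⟩, fun C => ⟨g C, hg1 C⟩, fun C => Subtype.ext (h1 C),
    fun C => Subtype.ext (h2 C)⟩, fun C => ⟨hf2 C, ?_⟩⟩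
  have := hg2 ⟨f C, hf1 C⟩
  rw [h1] at this
  exact this

lemma exists_mono (φ : GraphProduct Γ G ≃* GraphProduct Γ' G') {A : Set V} (hA : Γ.IsClique A)
    {A' : Set V'} (h : ∀ x ∈ GraphProduct.vsub Γ G A, ∀ b ∉ A', prj Γ' G' (φ x) b = 1) :
    ∃ f : (∀ a : A, G a) →* (∀ a : A', G' a), Function.Injective f := by
  let r : (∀ b, G' b) →* ∀ a : A', G' a := MonoidHom.pi fun a => Pi.evalMonoidHom G' a.1
  refine ⟨r.comp ((prj Γ' G').comp (φ.toMonoidHom.comp (cliq hA))), ?_⟩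
  rw [injective_iff_map_eq_one]
  intro x hx
  have hmem : cliq hA x ∈ GraphProduct.vsub Γ G A := by rw [← cliq_range hA]; exact ⟨x, rfl⟩
  have h1 : prj Γ' G' (φ (cliq hA x)) = 1 := by
    ext b
    by_cases hb : b ∈ A'
    · exact congrFun hx ⟨b, hb⟩
    · exact h _ hmem b hb
  obtain ⟨C', hC', g, hg⟩ := rel_exists φ hA
  have h2 : g⁻¹ * φ (cliq hA x) * g = 1 := by
    refine prj_inj hC'.1 (hg _ hmem) ?_
    rw [map_mul, map_mul, h1, map_inv]; simp
  have h3 : φ (cliq hA x) = 1 := by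
    have : g * (g⁻¹ * φ (cliq hA x) * g) * g⁻¹ = 1 := by rw [h2]; simp
    rw [← this]; group
  have h4 : cliq hA x = 1 := by simpa using h3
  exact cliq_injective hA (by rw [h4, map_one])

/-- A bare copy of `Fin n`. -/
def FinT (n : ℕ) : Type := Fin n

/-- Isomorphism types of finite groups. -/
def isoType (H : Type w) [Group H] : Set (Σ n : ℕ, Group (FinT n)) :=
  {p | letI := p.2; Nonempty (H ≃* FinT p.1)}

lemma isoType_eq {H : Type v} {K : Type w} [Group H] [Group K] (e : H ≃* K) :
    isoType H = isoType K := by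
  ext p
  letI := p.2
  exact ⟨fun ⟨f⟩ => ⟨e.symm.trans f⟩, fun ⟨f⟩ => ⟨e.trans f⟩⟩

lemma iso_of_isoType {H : Type v} {K : Type w} [Group H] [Group K] [Finite H]
    (h : isoType H = isoType K) : Nonempty (H ≃* K) := by
  let e : H ≃ FinT (Nat.card H) := Finite.equivFin H
  letI : Group (FinT (Nat.card H)) := e.symm.group
  have f : H ≃* FinT (Nat.card H) := (e.symm.mulEquiv).symm
  have h1 : (⟨Nat.card H, e.symm.group⟩ : Σ n : ℕ, Group (FinT n)) ∈ isoType H := ⟨f⟩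
  rw [h] at h1
  have h2 : Nonempty (K ≃* FinT (Nat.card H)) := h1
  exact ⟨f.trans h2.some.symm⟩

lemma counting {X : Type u} {Y : Type v} {M : Type w} {T : Type u'} [Finite X] [Finite Y]
    [Finite M] (s : X → Set M) (t : Y → Set M) (τ : X → T) (τ' : Y → T)
    (hs : ∀ a, (s a).Nonempty) (ht : ∀ a, (t a).Nonempty)
    (h : ∀ S : Set M, S.Nonempty → ∃ e : {a // S ⊆ s a} ≃ {a // S ⊆ t a}, ∀ a, τ' (e a) = τ a) :
    ∃ ψ : X ≃ Y, ∀ a, t (ψ a) = s a ∧ τ' (ψ a) = τ a := by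
  classical
  have := Fintype.ofFinite X
  have := Fintype.ofFinite Y
  have := Fintype.ofFinite M
  have key : ∀ c : T, ∀ S : Set M,
      (Finset.univ.filter fun a : X => s a = S ∧ τ a = c).card =
      (Finset.univ.filter fun a : Y => t a = S ∧ τ' a = c).card := by
    intro c S
    induction S using WellFoundedGT.induction with
    | ind S ih =>
    rcases S.eq_empty_or_nonempty with rfl | hS
    · rw [Finset.filter_false_of_mem, Finset.filter_false_of_mem]
      · rfl
      · rintro a - ⟨h1, -⟩
        exact (ht a).ne_empty h1
      · rintro a - ⟨h1, -⟩
        exact (hs a).ne_empty h1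
    · have h1 : (Finset.univ.filter fun a : X => S ⊆ s a ∧ τ a = c).card =
          (Finset.univ.filter fun a : Y => S ⊆ t a ∧ τ' a = c).card := by
        obtain ⟨e, he⟩ := h S hS
        refine Finset.card_bij' (fun a ha => (e ⟨a, (Finset.mem_filter.mp ha).2.1⟩).1)
          (fun a ha => (e.symm ⟨a, (Finset.mem_filter.mp ha).2.1⟩).1) ?_ ?_ ?_ ?_
        · intro a ha
          have := Finset.mem_filter.mp ha
          simp only [Finset.mem_filter, Finset.mem_univ, true_and]
          exact ⟨(e _).2, by rw [he]; exact this.2.2⟩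
        · intro a ha
          have := Finset.mem_filter.mp ha
          simp only [Finset.mem_filter, Finset.mem_univ, true_and]
          exact ⟨(e.symm _).2, by rw [← he]; simpa using this.2.2⟩
        · intro a ha; simp
        · intro a ha; simp
      have h2 : (Finset.univ.filter fun a : X => S ⊆ s a ∧ τ a = c).card =
          ∑ R ∈ Finset.univ.filter (fun R : Set M => S ⊆ R),
            (Finset.univ.filter fun a : X => s a = R ∧ τ a = c).card := by
        rw [Finset.card_eq_sum_card_fiberwise (f := s)
          (t := Finset.univ.filter (fun R : Set M => S ⊆ R))]
        · refine Finset.sum_congr rfl fun R hR => ?_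
          congr 1
          ext a
          simp only [Finset.mem_filter, Finset.mem_univ, true_and] at hR ⊢
          constructor
          · rintro ⟨⟨-, h1⟩, h2⟩; exact ⟨h2, h1⟩
          · rintro ⟨h1, h2⟩; exact ⟨⟨h1 ▸ hR, h2⟩, h1⟩
        · intro a ha
          simp only [Finset.coe_filter, Finset.mem_univ, true_and, Set.mem_ofPred_eq] at ha ⊢
          exact ha.1
      have h3 : (Finset.univ.filter fun a : Y => S ⊆ t a ∧ τ' a = c).card =
          ∑ R ∈ Finset.univ.filter (fun R : Set M => S ⊆ R),
            (Finset.univ.filter fun a : Y => t a = R ∧ τ' a = c).card := by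
        rw [Finset.card_eq_sum_card_fiberwise (f := t)
          (t := Finset.univ.filter (fun R : Set M => S ⊆ R))]
        · refine Finset.sum_congr rfl fun R hR => ?_
          congr 1
          ext a
          simp only [Finset.mem_filter, Finset.mem_univ, true_and] at hR ⊢
          constructor
          · rintro ⟨⟨-, h1⟩, h2⟩; exact ⟨h2, h1⟩
          · rintro ⟨h1, h2⟩; exact ⟨⟨h1 ▸ hR, h2⟩, h1⟩
        · intro a ha
          simp only [Finset.coe_filter, Finset.mem_univ, true_and, Set.mem_ofPred_eq] at ha ⊢
          exact ha.1
      have hmem : S ∈ Finset.univ.filter (fun R : Set M => S ⊆ R) := by simp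
      rw [h2, h3, ← Finset.add_sum_erase _ _ hmem, ← Finset.add_sum_erase _ _ hmem] at h1
      have h4 : ∀ R ∈ (Finset.univ.filter (fun R : Set M => S ⊆ R)).erase S,
          (Finset.univ.filter fun a : X => s a = R ∧ τ a = c).card =
          (Finset.univ.filter fun a : Y => t a = R ∧ τ' a = c).card := by
        intro R hR
        simp only [Finset.mem_erase, Finset.mem_filter, Finset.mem_univ, true_and] at hR
        exact ih R (lt_of_le_of_ne hR.2 (Ne.symm hR.1))
      rw [Finset.sum_congr rfl h4] at h1
      exact Nat.add_right_cancel h1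
  have e : ∀ p : Set M × T, {a // (s a, τ a) = p} ≃ {a // (t a, τ' a) = p} := by
    intro p
    apply Fintype.equivOfCardEq
    rw [Fintype.card_subtype, Fintype.card_subtype]
    simpa only [Prod.ext_iff] using key p.2 p.1
  refine ⟨Equiv.ofFiberEquiv e, fun a => ?_⟩
  have := Equiv.ofFiberEquiv_map e a
  exact Prod.ext_iff.mp this

lemma adj_iff {V : Type u} [Finite V] (Γ : SimpleGraph V) (a b : V) :
    Γ.Adj a b ↔ a ≠ b ∧ ∃ C : {C // Maximal Γ.IsClique C}, a ∈ C.1 ∧ b ∈ C.1 := by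
  constructor
  · intro h
    have hc : Γ.IsClique {a, b} := by
      rw [SimpleGraph.isClique_pair]; exact fun _ => h
    obtain ⟨C, h1, h2⟩ := Finite.exists_le_maximal hc
    exact ⟨h.ne, ⟨C, h2⟩, h1 (by simp), h1 (by simp)⟩
  · rintro ⟨h, C, ha, hb⟩
    exact C.2.1 ha hb h

lemma mem_max {V : Type u} [Finite V] (Γ : SimpleGraph V) (a : V) :
    ∃ C : {C // Maximal Γ.IsClique C}, a ∈ C.1 := by
  have hc : Γ.IsClique {a} := SimpleGraph.isClique_singleton a
  obtain ⟨C, h1, h2⟩ := Finite.exists_le_maximal hc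
  exact ⟨⟨C, h2⟩, h1 (by simp)⟩

theorem rigidity (hind : ∀ v : V, DirectlyIndecomposable (G v))
    (hind' : ∀ v' : V', DirectlyIndecomposable (G' v'))
    (φ : GraphProduct Γ G ≃* GraphProduct Γ' G') :
    ∃ ψ : Γ ≃g Γ', ∀ v : V, Nonempty (G v ≃* G' (ψ v)) := by
  obtain ⟨σ, hσ⟩ := exists_sigma φ (fun v => (hind v).1) (fun v => (hind' v).1)
  obtain ⟨ψ, hψ⟩ := counting (fun a : V => {C : {C // Maximal Γ.IsClique C} | a ∈ C.1})
    (fun a : V' => {C : {C // Maximal Γ.IsClique C} | a ∈ (σ C).1})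
    (fun a => isoType (G a)) (fun a => isoType (G' a))
    (fun a => mem_max Γ a)
    (fun a => by
      obtain ⟨C, hC⟩ := mem_max Γ' a
      exact ⟨σ.symm C, by simpa using hC⟩)
    (by
      intro S ⟨C₀, hC₀⟩
      let A : Set V := {a | S ⊆ {C : {C // Maximal Γ.IsClique C} | a ∈ C.1}}
      let A' : Set V' := {a | S ⊆ {C : {C // Maximal Γ.IsClique C} | a ∈ (σ C).1}}
      have hAC : ∀ C ∈ S, A ⊆ C.1 := fun C hC a ha => ha hC
      have hAC' : ∀ C ∈ S, A' ⊆ (σ C).1 := fun C hC a ha => ha hC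
      have hA : Γ.IsClique A := C₀.2.1.subset (hAC C₀ hC₀)
      have hA' : Γ'.IsClique A' := (σ C₀).2.1.subset (hAC' C₀ hC₀)
      obtain ⟨f, hf⟩ := exists_mono φ hA (A' := A') (by
        intro y hy b hb
        obtain ⟨C, hC, hbC⟩ := Set.not_subset.mp hb
        exact (hσ C).1.prj (vsub_mono (hAC C hC) hy) hbC)
      obtain ⟨g, hg⟩ := exists_mono φ.symm hA' (A' := A) (by
        intro y hy b hb
        obtain ⟨C, hC, hbC⟩ := Set.not_subset.mp hb
        exact (hσ C).2.prj (vsub_mono (hAC' C hC) hy) hbC)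
      have hbij : Function.Bijective f :=
        hf.bijective_of_nat_card_le (Nat.card_le_card_of_injective g hg)
      obtain ⟨e, he⟩ := krull_schmidt _ rfl (fun a : A => G a) (fun a : A' => G' a)
        (fun a => hind a) (fun a => hind' a) (MulEquiv.ofBijective f hbij)
      exact ⟨e, fun a => by
        obtain ⟨i⟩ := he a
        exact (isoType_eq i).symm⟩)
  refine ⟨⟨ψ, ?_⟩, fun a => iso_of_isoType (hψ a).2.symm⟩
  intro a b
  have hm : ∀ a C, ψ a ∈ (σ C).1 ↔ a ∈ C.1 := fun a C => Set.ext_iff.mp (hψ a).1 C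
  rw [adj_iff, adj_iff]
  refine and_congr (not_congr ψ.injective.eq_iff) ?_
  constructor
  · rintro ⟨C, h1, h2⟩
    refine ⟨σ.symm C, ?_, ?_⟩
    · rw [← hm]; simpa using h1
    · rw [← hm]; simpa using h2
  · rintro ⟨C, h1, h2⟩
    exact ⟨σ C, (hm _ _).mpr h1, (hm _ _).mpr h2⟩

end Final

end GPRigid

/-- If the graph products of `(Γ, G)` and `(Γ', G')`, where all vertex groups
are directly indecomposable nontrivial finite groups, are isomorphic, then there is a graph
isomorphism `ψ : Γ ≃g Γ'` with `G_v ≅ G'_{ψ v}` for all `v`: a representation of a group as a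
graph product of directly indecomposable finite groups is unique. -/
theorem graphProduct_rigidity_indecomposable {V V' : Type*} [Fintype V] [Fintype V']
    (Γ : SimpleGraph V) (Γ' : SimpleGraph V')
    (G : V → Type*) [∀ v, Group (G v)] [∀ v, Finite (G v)]
    (G' : V' → Type*) [∀ v', Group (G' v')] [∀ v', Finite (G' v')]
    (hind : ∀ v : V, DirectlyIndecomposable (G v))
    (hind' : ∀ v' : V', DirectlyIndecomposable (G' v'))
    (hiso : Nonempty (GraphProduct Γ G ≃* GraphProduct Γ' G')) :
    ∃ ψ : Γ ≃g Γ', ∀ v : V, Nonempty (G v ≃* G' (ψ v)) := by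
  obtain ⟨φ⟩ := hiso
  exact GPRigid.rigidity hind hind' φ
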